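/- If the maximum of x_0,…,x_n ∈ ℝ is attained at a unique index j*, then f_α(x) := α · Σ_i Σ_{j≠i} e^{α(x_i + x_j)} / ( Σ_k e^{α x_k} )² → 0 as α → ∞. -/

import Mathlib

open Filter Finset Topology

lemma tendsto_mul_exp_neg_mul_atTop_nhds_zero {c : ℝ} (hc : 0 < c) :
    Tendsto (fun α : ℝ => α * Real.exp (-c * α)) atTop (𝓝 0) := by
  simpa using tendsto_rpow_mul_exp_neg_mul_atTop_nhds_zero 1 c hc

/-- The square of a sum of exponentials dominates the square of each of its terms. -/
lemma exp_div_sq_sum_exp_le {ι : Type*} [Fintype ι] (x : ι → ℝ) (m : ι) (α s : ℝ) :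
    Real.exp (α * s) / (∑ k, Real.exp (α * x k)) ^ 2 ≤
      Real.exp (-(2 * x m - s) * α) := by
  have hle : Real.exp (α * x m) ≤ ∑ k, Real.exp (α * x k) :=
    Finset.single_le_sum (f := fun k => Real.exp (α * x k))
      (fun k _ => (Real.exp_pos _).le) (Finset.mem_univ m)
  calc Real.exp (α * s) / (∑ k, Real.exp (α * x k)) ^ 2
      ≤ Real.exp (α * s) / Real.exp (α * x m) ^ 2 := by gcongr
    _ = Real.exp (-(2 * x m - s) * α) := by
      rw [← Real.exp_nat_mul, ← Real.exp_sub]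
      congr 1
      push_cast
      ring

/-- If the maximum is attained at a unique index then f_α tends to 0. -/
theorem f_alpha_tendsto_zero_of_unique_max (n : ℕ) (x : Fin (n+1) → ℝ)
    (jstar : Fin (n+1)) (hj : ∀ j, j ≠ jstar → x j < x jstar) :
    Tendsto (fun α : ℝ =>
        α * ∑ i, ∑ j ∈ Finset.univ.erase i,
          Real.exp (α * (x i + x j)) / (∑ k, Real.exp (α * x k)) ^ 2) atTop
      (𝓝 0) := by
  have hle (i : Fin (n+1)) : x i ≤ x jstar := by
    rcases eq_or_ne i jstar with rfl | h
    · exact le_rfl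
    · exact (hj i h).le
  simp only [Finset.mul_sum]
  rw [show (0 : ℝ) = ∑ i : Fin (n+1), ∑ j ∈ Finset.univ.erase i, (0 : ℝ) by simp]
  refine tendsto_finsetSum _ fun i _ => tendsto_finsetSum _ fun j hji => ?_
  have hc : 0 < 2 * x jstar - (x i + x j) := by
    rcases eq_or_ne i jstar with rfl | h
    · linarith [hj j (Finset.ne_of_mem_erase hji)]
    · linarith [hj i h, hle j]
  refine tendsto_of_tendsto_of_tendsto_of_le_of_le' tendsto_const_nhds
    (tendsto_mul_exp_neg_mul_atTop_nhds_zero hc) ?_ ?_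
  · filter_upwards [eventually_ge_atTop 0] with α hα
    positivity
  · filter_upwards [eventually_ge_atTop 0] with α hα
    exact mul_le_mul_of_nonneg_left (exp_div_sq_sum_exp_le x jstar α _) hα
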